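/- Let G ∈ 𝒞𝒢^s(n) with 2 ≤ s ≤ n−3, let v* be a vertex of minimum degree t of G, and set Y = V(G) ∖ N[v*]. Then Y is nonempty and the induced subgraph G[Y] is isomorphic to K_{n_1,…,n_l} ∪ rK_1, i.e., the disjoint union of a complete multipartite graph and r isolated vertices, where n_1+⋯+n_l+r = n−t−1 (equivalently, G[Y] has at most one positive eigenvalue). -/

import Mathlib

open Matrix BigOperators

namespace TwoPosEig

variable {V : Type*}

/-- The real adjacency matrix of a simple graph (classical decidability). -/
noncomputable def adjMat [Fintype V] [DecidableEq V] (G : SimpleGraph V) : Matrix V V ℝ :=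
  letI := Classical.decRel G.Adj
  G.adjMatrix ℝ

lemma adjMat_isHermitian [Fintype V] [DecidableEq V] (G : SimpleGraph V) :
    (adjMat G).IsHermitian := by
  letI := Classical.decRel G.Adj
  rw [Matrix.IsHermitian, Matrix.conjTranspose_eq_transpose_of_trivial]
  exact SimpleGraph.isSymm_adjMatrix G

/-- The eigenvalues of (the adjacency matrix of) a graph, as a function on vertices. -/
noncomputable def eigs [Fintype V] [DecidableEq V] (G : SimpleGraph V) : V → ℝ :=
  (adjMat_isHermitian G).eigenvalues

/-- `p(G)`: the number of positive eigenvalues (with multiplicity). -/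
noncomputable def posCount [Finite V] (G : SimpleGraph V) : ℕ :=
  letI := Fintype.ofFinite V
  letI := Classical.decEq V
  Nat.card {i : V // 0 < eigs G i}

/-- `η(G)`: the number of zero eigenvalues (with multiplicity), the nullity. -/
noncomputable def nullCount [Finite V] (G : SimpleGraph V) : ℕ :=
  letI := Fintype.ofFinite V
  letI := Classical.decEq V
  Nat.card {i : V // eigs G i = 0}

/-- `λ_k(G)`: the `k`-th largest eigenvalue (1-indexed); junk value `0` out of range. -/
noncomputable def lam [Finite V] (G : SimpleGraph V) (k : ℕ) : ℝ :=
  letI := Fintype.ofFinite V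
  letI := Classical.decEq V
  (((Finset.univ.val.map (eigs G)).sort (· ≤ ·)).reverse).getD (k - 1) 0

/-- Membership in `𝒢^s(n)` (the order `n` being the cardinality of the vertex type):
`p(G) = 2` and `η(G) = s`. -/
def memClass [Finite V] (s : ℕ) (G : SimpleGraph V) : Prop :=
  posCount G = 2 ∧ nullCount G = s

/-- `v` is a congruent vertex of I-type: some other vertex `u`, non-adjacent to `v`,
has the same neighbourhood. -/
def ITypeVertex (G : SimpleGraph V) (v : V) : Prop :=
  ∃ u, u ≠ v ∧ ¬ G.Adj u v ∧ G.neighborSet u = G.neighborSet v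

/-- `u` is a congruent vertex of II-type: there are two non-adjacent vertices `v, w`
such that `N(u)` is a disjoint union of `N(v)` and `N(w)`. -/
def IITypeVertex (G : SimpleGraph V) (u : V) : Prop :=
  ∃ v w, v ≠ w ∧ ¬ G.Adj v w ∧ Disjoint (G.neighborSet v) (G.neighborSet w) ∧
    G.neighborSet u = G.neighborSet v ∪ G.neighborSet w

/-- `u v x y` is a congruent (induced) quadrangle with congruent edges `uv`, `xy`. -/
def CongruentQuad (G : SimpleGraph V) (u v x y : V) : Prop :=
  u ≠ v ∧ u ≠ x ∧ u ≠ y ∧ v ≠ x ∧ v ≠ y ∧ x ≠ y ∧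
  G.Adj u v ∧ G.Adj v x ∧ G.Adj x y ∧ G.Adj y u ∧ ¬ G.Adj u x ∧ ¬ G.Adj v y ∧
  G.neighborSet u \ {y, v} = G.neighborSet v \ {u, x} ∧
  G.neighborSet x \ {v, y} = G.neighborSet y \ {x, u}

/-- A congruent vertex of III-type: a vertex of some congruent quadrangle. -/
def IIITypeVertex (G : SimpleGraph V) (z : V) : Prop :=
  ∃ u v x y, CongruentQuad G u v x y ∧ (z = u ∨ z = v ∨ z = x ∨ z = y)

/-- Membership in `𝒢_1^s(n)`: a connected graph obtained by adding a congruent vertex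
of I-type to some graph in `𝒢^{s-1}(n-1)`. -/
def memG1 {n : ℕ} (s : ℕ) (G : SimpleGraph (Fin n)) : Prop :=
  G.Connected ∧ ∃ v : Fin n, ITypeVertex G v ∧ memClass (s - 1) (G.induce {v}ᶜ)

/-- Membership in `𝒢_2^s(n)`. -/
def memG2 {n : ℕ} (s : ℕ) (G : SimpleGraph (Fin n)) : Prop :=
  G.Connected ∧ ∃ v : Fin n, IITypeVertex G v ∧ memClass (s - 1) (G.induce {v}ᶜ)

/-- Membership in `𝒢_3^s(n)`. -/
def memG3 {n : ℕ} (s : ℕ) (G : SimpleGraph (Fin n)) : Prop :=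
  G.Connected ∧ ∃ v : Fin n, IIITypeVertex G v ∧ memClass (s - 1) (G.induce {v}ᶜ)

/-- Oboudi's graph `G_m`: two cliques `K_{⌈m/2⌉}` (on `v_1, …`) and `K_{⌊m/2⌋}`
(on `w_1, …`), where `v_i ∼ w_j` iff `j ≥ ⌊m/2⌋ - i + 2` (1-indexed), i.e. (0-indexed)
`⌊m/2⌋ ≤ i + j`. -/
def oboudi (m : ℕ) : SimpleGraph (Fin ((m + 1) / 2) ⊕ Fin (m / 2)) :=
  SimpleGraph.fromRel fun a b =>
    match a, b with
    | Sum.inl _, Sum.inl _ => True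
    | Sum.inr _, Sum.inr _ => True
    | Sum.inl i, Sum.inr j => m / 2 ≤ (i : ℕ) + (j : ℕ)
    | Sum.inr _, Sum.inl _ => False

/-- The generalized lexicographic product `G[K_{t v}]`: each vertex `v` is replaced by a
clique of order `t v`, with complete joins along edges of `G`. -/
def lexProd (G : SimpleGraph V) (t : V → ℕ) : SimpleGraph (Σ v : V, Fin (t v)) :=
  SimpleGraph.fromRel fun a b => a.1 = b.1 ∨ G.Adj a.1 b.1

/-- Index conversion identifying the vertices `v_1, …, v_{⌈k/2⌉}, w_1, …, w_{⌊k/2⌋}`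
of `G_k` with `Fin k` (in this order). -/
def toIdx {k : ℕ} : Fin ((k + 1) / 2) ⊕ Fin (k / 2) → Fin k
  | Sum.inl i => ⟨(i : ℕ), by have := i.isLt; omega⟩
  | Sum.inr j => ⟨(k + 1) / 2 + (j : ℕ), by have := j.isLt; omega⟩

/-- `B_k(n_1, …, n_k) = G_k[K_{n_1}, …, K_{n_k}]`. -/
def bGraph (k : ℕ) (nn : Fin k → ℕ) :
    SimpleGraph (Σ v : Fin ((k + 1) / 2) ⊕ Fin (k / 2), Fin (nn (toIdx v))) :=
  lexProd (oboudi k) fun v => nn (toIdx v)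

/-- Membership in `𝓓* = {B_k(n_1,…,n_k) ∈ 𝓑_k^{00}(n) : 4 ≤ k ≤ 14, n ≤ 14}` (up to
isomorphism). -/
def memDstar {n : ℕ} (G : SimpleGraph (Fin n)) : Prop :=
  ∃ (k : ℕ) (nn : Fin k → ℕ), 4 ≤ k ∧ k ≤ 14 ∧ (∀ i, 1 ≤ nn i) ∧ (∑ i, nn i) ≤ 14 ∧
    lam (bGraph k nn) 3 = 0 ∧ lam (bGraph k nn) 4 = 0 ∧ Nonempty (G ≃g bGraph k nn)

/-- The degree of a vertex. -/
noncomputable def deg [Finite V] (G : SimpleGraph V) (v : V) : ℕ :=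
  Nat.card (G.neighborSet v)

/-- `v` is a vertex of minimum degree. -/
def IsMinDegVertex [Finite V] (G : SimpleGraph V) (v : V) : Prop :=
  ∀ w, deg G v ≤ deg G w

/-- The set `Y = V(G) ∖ N[v]`. -/
def Yset (G : SimpleGraph V) (v : V) : Set V :=
  (G.neighborSet v ∪ {v})ᶜ

/-- `G` is `X`-complete with respect to `v`: `G[Y] ≅ K_{n-t-1}` with `n-t-1 ≥ 2`
and `G[X]` is complete, where `X = N(v)`, `Y = V(G) ∖ N[v]`. -/
def IsXComplete [Finite V] (G : SimpleGraph V) (v : V) : Prop :=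
  2 ≤ (Yset G v).ncard ∧ (Yset G v).Pairwise G.Adj ∧ (G.neighborSet v).Pairwise G.Adj

/-- An `X`-complete graph is reduced when the traces on `Y` of the neighbourhoods of
vertices of `X` form a chain. -/
def IsReduced (G : SimpleGraph V) (v : V) : Prop :=
  ∀ x ∈ G.neighborSet v, ∀ x' ∈ G.neighborSet v,
    G.neighborSet x ∩ Yset G v ⊆ G.neighborSet x' ∩ Yset G v ∨
    G.neighborSet x' ∩ Yset G v ⊆ G.neighborSet x ∩ Yset G v


lemma sq_pos_of_ne' {x : ℝ} (h : x ≠ 0) : 0 < x ^ 2 := by positivity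

noncomputable def qform {V : Type*} [Fintype V] [DecidableEq V] (G : SimpleGraph V) (x : V → ℝ) : ℝ :=
  x ⬝ᵥ (adjMat G *ᵥ x)

lemma adjMat_apply' {V : Type*} [Fintype V] [DecidableEq V] (G : SimpleGraph V) (a b : V) :
    adjMat G a b = (open Classical in if G.Adj a b then (1:ℝ) else 0) := by
  unfold adjMat
  simp only [SimpleGraph.adjMatrix_apply]

lemma adjMat_symm {V : Type*} [Fintype V] [DecidableEq V] (G : SimpleGraph V) (a b : V) :
    adjMat G a b = adjMat G b a := by
  rw [adjMat_apply', adjMat_apply', SimpleGraph.adj_comm]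

lemma dot_symm {V : Type*} [Fintype V] [DecidableEq V] (G : SimpleGraph V) (x y : V → ℝ) :
    x ⬝ᵥ (adjMat G *ᵥ y) = y ⬝ᵥ (adjMat G *ᵥ x) := by
  simp only [dotProduct, mulVec, Finset.mul_sum]
  rw [Finset.sum_comm]
  refine Finset.sum_congr rfl fun i _ => Finset.sum_congr rfl fun j _ => ?_
  rw [adjMat_symm]; ring

lemma posCount_eq {V : Type*} [i1 : Fintype V] [i2 : DecidableEq V] (G : SimpleGraph V) :
    posCount G = Fintype.card {i : V // 0 < eigs G i} := by
  rw [← Nat.card_eq_fintype_card]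
  unfold posCount
  have key : ∀ (j1 : Fintype V) (j2 : DecidableEq V),
      Nat.card {i : V // 0 < @eigs V j1 j2 G i} = Nat.card {i : V // 0 < @eigs V i1 i2 G i} := by
    intro j1 j2
    obtain rfl : j1 = i1 := Subsingleton.elim _ _
    obtain rfl : j2 = i2 := Subsingleton.elim _ _
    rfl
  exact key _ _

noncomputable def eb {V : Type*} [Fintype V] [DecidableEq V] (G : SimpleGraph V) :
    OrthonormalBasis V ℝ (EuclideanSpace ℝ V) := (adjMat_isHermitian G).eigenvectorBasis

lemma qform_eq {V : Type*} [Fintype V] [DecidableEq V] (G : SimpleGraph V) (x : V → ℝ) :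
    qform G x = ∑ i, eigs G i * (inner ℝ (eb G i) (WithLp.toLp 2 x)) ^ 2 := by
  have h1 : qform G x = inner ℝ (WithLp.toLp 2 x) (WithLp.toLp 2 (adjMat G *ᵥ x)) := by
    simp [qform, EuclideanSpace.inner_toLp_toLp, dotProduct_comm]
  rw [h1, ← (eb G).sum_inner_mul_inner]
  refine Finset.sum_congr rfl fun i _ => ?_
  have h2 : inner ℝ (eb G i) (WithLp.toLp 2 (adjMat G *ᵥ x)) =
      eigs G i * inner ℝ (eb G i) (WithLp.toLp 2 x) := by
    have e := (adjMat_isHermitian G).mulVec_eigenvectorBasis i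
    have a1 : ∀ y : V → ℝ, inner ℝ (eb G i) (WithLp.toLp 2 y) = y ⬝ᵥ (eb G i).ofLp := by
      intro y
      simp [EuclideanSpace.inner_eq_star_dotProduct]
    rw [a1, a1, dotProduct_comm, dot_symm]
    unfold eb eigs
    rw [e]
    simp
  rw [h2, real_inner_comm]; ring

lemma le_posCount {V : Type*} [Fintype V] [DecidableEq V] (G : SimpleGraph V)
    {E : Type*} [AddCommGroup E] [Module ℝ E] [FiniteDimensional ℝ E]
    (f : E →ₗ[ℝ] (V → ℝ)) (hf : ∀ e, e ≠ 0 → 0 < qform G (f e)) :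
    Module.finrank ℝ E ≤ posCount G := by
  rw [posCount_eq, ← Module.finrank_fintype_fun_eq_card ℝ]
  let g : E →ₗ[ℝ] ({i : V // 0 < eigs G i} → ℝ) :=
    { toFun := fun e i => inner ℝ (eb G i) (WithLp.toLp 2 (f e))
      map_add' := by intro x y; ext i; simp [inner_add_right]
      map_smul' := by intro c x; ext i; simp [inner_smul_right] }
  refine LinearMap.finrank_le_finrank_of_injective (f := g) ?_
  rw [← LinearMap.ker_eq_bot, LinearMap.ker_eq_bot']
  intro e he
  by_contra hne
  have h := hf e hne
  rw [qform_eq] at h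
  refine absurd h (not_lt.mpr (Finset.sum_nonpos fun i _ => ?_))
  by_cases hi : 0 < eigs G i
  · have : inner ℝ (eb G i) (WithLp.toLp 2 (f e)) = 0 := congrFun he ⟨i, hi⟩
    rw [this]; simp
  · exact mul_nonpos_of_nonpos_of_nonneg (not_lt.mp hi) (sq_nonneg _)

lemma exists_pos {V : Type*} [Fintype V] [DecidableEq V] (G : SimpleGraph V) :
    ∃ f : ({i : V // 0 < eigs G i} → ℝ) →ₗ[ℝ] (V → ℝ), ∀ e, e ≠ 0 → 0 < qform G (f e) := by
  let ext : ({i : V // 0 < eigs G i} → ℝ) →ₗ[ℝ] (V → ℝ) :=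
    { toFun := fun c i => if h : 0 < eigs G i then c ⟨i, h⟩ else 0
      map_add' := by intro x y; ext i; by_cases h : 0 < eigs G i <;> simp [h]
      map_smul' := by intro c x; ext i; by_cases h : 0 < eigs G i <;> simp [h] }
  let f : ({i : V // 0 < eigs G i} → ℝ) →ₗ[ℝ] (V → ℝ) :=
    { toFun := fun c => ((eb G).repr.symm (WithLp.toLp 2 (ext c))).ofLp
      map_add' := by intro x y; simp
      map_smul' := by intro c x; simp }
  refine ⟨f, fun e he => ?_⟩
  have key : ∀ i, inner ℝ (eb G i) (WithLp.toLp 2 (f e)) = ext e i := by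
    intro i
    rw [← OrthonormalBasis.repr_apply_apply]
    simp [f]
  rw [qform_eq]
  simp only [key]
  obtain ⟨⟨i, hi⟩, hne⟩ := Function.ne_iff.mp he
  refine Finset.sum_pos' (fun j _ => ?_) ⟨i, Finset.mem_univ _, ?_⟩
  · by_cases h : 0 < eigs G j
    · exact mul_nonneg h.le (sq_nonneg _)
    · simp [ext, h]
  · have : ext e i = e ⟨i, hi⟩ := by simp [ext, hi]
    rw [this]
    exact mul_pos hi (sq_pos_of_ne' hne)

/-- The extension trick. -/
lemma succ_le_posCount {V : Type*} [Fintype V] [DecidableEq V] (G : SimpleGraph V)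
    {E : Type*} [AddCommGroup E] [Module ℝ E] [FiniteDimensional ℝ E]
    (f : E →ₗ[ℝ] (V → ℝ)) (hf : ∀ e, e ≠ 0 → 0 < qform G (f e))
    (u v : V) (huv : G.Adj u v) (h0 : ∀ e, (adjMat G *ᵥ (f e)) v = 0) :
    Module.finrank ℝ E + 1 ≤ posCount G := by
  have hfr : Module.finrank ℝ (E × ℝ) = Module.finrank ℝ E + 1 := by simp
  rw [← hfr]
  let sv : V → ℝ := Pi.single v 1
  let su : V → ℝ := Pi.single u 1
  let g : (E × ℝ) →ₗ[ℝ] (V → ℝ) :=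
    { toFun := fun p => f p.1 - (adjMat G *ᵥ (f p.1)) u • sv + p.2 • (su + sv)
      map_add' := by intro x y; ext i; simp [mulVec_add]; ring
      map_smul' := by intro c x; ext i; simp [mulVec_smul]; ring }
  have key : ∀ p : E × ℝ, qform G (g p) = qform G (f p.1) + 2 * p.2 ^ 2 := by
    intro p
    have hv : ∀ x : V → ℝ, sv ⬝ᵥ x = x v := by intro x; simp [sv]
    have hu : ∀ x : V → ℝ, su ⬝ᵥ x = x u := by intro x; simp [su]
    have hAv : ∀ w, (adjMat G *ᵥ sv) w = adjMat G w v := by intro w; simp [sv]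
    have hAu : ∀ w, (adjMat G *ᵥ su) w = adjMat G w u := by intro w; simp [su]
    have e1 : adjMat G u v = 1 := by rw [adjMat_apply', if_pos huv]
    have e2 : adjMat G v u = 1 := by rw [adjMat_apply', if_pos huv.symm]
    have e3 : adjMat G u u = 0 := by rw [adjMat_apply', if_neg (G.loopless.irrefl u)]
    have e4 : adjMat G v v = 0 := by rw [adjMat_apply', if_neg (G.loopless.irrefl v)]
    have d1 := dot_symm G (f p.1) sv
    have d2 := dot_symm G (f p.1) su
    have h := h0 p.1
    show (f p.1 - (adjMat G *ᵥ (f p.1)) u • sv + p.2 • (su + sv)) ⬝ᵥ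
      (adjMat G *ᵥ (f p.1 - (adjMat G *ᵥ (f p.1)) u • sv + p.2 • (su + sv))) = _
    unfold qform
    simp only [mulVec_add, mulVec_sub, mulVec_smul, add_dotProduct, sub_dotProduct,
      smul_dotProduct, dotProduct_add, dotProduct_sub, dotProduct_smul, d1, d2, hv, hu, hAv, hAu,
      e1, e2, e3, e4, h, smul_eq_mul, Pi.add_apply, Pi.sub_apply, Pi.smul_apply]
    ring
  refine le_posCount G g fun p hp => ?_
  rw [key]
  by_cases h1 : p.1 = 0
  · have h2 : p.2 ≠ 0 := fun h2 => hp (Prod.ext h1 h2)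
    rw [h1, map_zero]
    have : qform G 0 = 0 := by simp [qform]
    rw [this]
    have := sq_pos_of_ne' h2
    linarith
  · have := hf _ h1
    positivity

lemma posCount_complete {V : Type*} [Fintype V] [DecidableEq V] (G : SimpleGraph V)
    (h : ∀ a b, a ≠ b → G.Adj a b) : posCount G ≤ 1 := by
  obtain ⟨f, hf⟩ := exists_pos G
  rw [posCount_eq, ← Module.finrank_fintype_fun_eq_card ℝ, ← Module.finrank_self ℝ]
  let g : ({i : V // 0 < eigs G i} → ℝ) →ₗ[ℝ] ℝ :=
    { toFun := fun e => ∑ i, f e i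
      map_add' := by intro x y; simp [Finset.sum_add_distrib]
      map_smul' := by intro c x; simp [Finset.mul_sum] }
  refine LinearMap.finrank_le_finrank_of_injective (f := g) ?_
  rw [← LinearMap.ker_eq_bot, LinearMap.ker_eq_bot']
  intro e he
  by_contra hne
  have hp := hf e hne
  have hs : ∑ i, f e i = 0 := he
  have : ∀ a, (adjMat G *ᵥ (f e)) a = - f e a := by
    intro a
    have : ∀ b, adjMat G a b * f e b = f e b - if a = b then f e b else 0 := by
      intro b
      rw [adjMat_apply']
      by_cases hab : a = b
      · subst hab; simp
      · simp [h a b hab, hab]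
    simp [mulVec, dotProduct, this, hs]
  refine absurd hp (not_lt.mpr (Finset.sum_nonpos fun i _ => ?_))
  rw [this]
  nlinarith [sq_nonneg (f e i)]

lemma posCount_induce {V : Type*} [Fintype V] [DecidableEq V] (G : SimpleGraph V)
    (u v : V) (huv : G.Adj u v) (Y : Set V) (hY : ∀ y ∈ Y, ¬ G.Adj v y) :
    posCount (G.induce Y) + 1 ≤ posCount G := by
  classical
  obtain ⟨f, hf⟩ := exists_pos (G.induce Y)
  rw [posCount_eq (G.induce Y), ← Module.finrank_fintype_fun_eq_card ℝ]
  let ext : (Y → ℝ) →ₗ[ℝ] (V → ℝ) :=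
    { toFun := fun c i => if h : i ∈ Y then c ⟨i, h⟩ else 0
      map_add' := by intro x y; ext i; by_cases h : i ∈ Y <;> simp [h]
      map_smul' := by intro c x; ext i; by_cases h : i ∈ Y <;> simp [h] }
  have hin : ∀ c (y : Y), ext c y = c y := by intro c y; simp [ext]
  have hout : ∀ c y, y ∉ Y → ext c y = 0 := by intro c y hy; simp [ext, hy]
  have hsum : ∀ k : V → ℝ, (∀ y, y ∉ Y → k y = 0) → ∑ i, k i = ∑ y : Y, k y := by
    intro k hk
    rw [← Finset.sum_subtype (Finset.univ.filter (· ∈ Y)) (by simp) k, Finset.sum_filter]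
    refine Finset.sum_congr rfl fun i _ => ?_
    by_cases hi : i ∈ Y
    · simp [hi]
    · simp [hi, hk i hi]
  refine succ_le_posCount G (ext ∘ₗ f) (fun e he => ?_) u v huv (fun e => ?_)
  · have := hf e he
    convert this using 1
    simp only [qform, dotProduct, mulVec, LinearMap.comp_apply]
    rw [hsum _ (fun y hy => by rw [hout _ _ hy, zero_mul])]
    refine Finset.sum_congr rfl fun a _ => ?_
    rw [hsum _ (fun y hy => by rw [hout _ _ hy, mul_zero])]
    simp only [hin]
    congr 1
  · simp only [mulVec, dotProduct]
    refine Finset.sum_eq_zero fun y _ => ?_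
    by_cases hy : y ∈ Y
    · rw [adjMat_apply', if_neg (hY y hy), zero_mul]
    · rw [LinearMap.comp_apply, hout _ _ hy, mul_zero]

lemma nonadj_trans {V : Type*} [Fintype V] [DecidableEq V] (G : SimpleGraph V)
    (hG : posCount G ≤ 1) (a b c d : V) (hbd : G.Adj b d) (hab : ¬ G.Adj a b) (hbc : ¬ G.Adj b c) :
    ¬ G.Adj a c := by
  intro hac
  have hba : ¬ G.Adj b a := fun h => hab h.symm
  let f : ℝ →ₗ[ℝ] (V → ℝ) := LinearMap.toSpanSingleton ℝ _ (Pi.single a 1 + Pi.single c 1)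
  have h := succ_le_posCount G f (fun e he => ?_) d b hbd.symm (fun e => ?_)
  · rw [Module.finrank_self] at h; omega
  · have : qform G (f e) = 2 * e ^ 2 := by
      simp [qform, f, mulVec_add, mulVec_smul, adjMat_apply', hac, hac.symm]
      ring
    rw [this]
    have := sq_pos_of_ne' he
    linarith
  · simp [f, mulVec_add, mulVec_smul, adjMat_apply', hba, hbc]

lemma exists_iso {W : Type*} [Finite W] (H : SimpleGraph W)
    (hH : ∀ a b c d, H.Adj b d → ¬ H.Adj a b → ¬ H.Adj b c → ¬ H.Adj a c) :
    ∃ (l r : ℕ) (nn : Fin l → ℕ), (∀ i, 1 ≤ nn i) ∧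
      (∑ i, nn i) + r = Nat.card W ∧
      Nonempty (H ≃g
        ((SimpleGraph.completeMultipartiteGraph fun i => Fin (nn i)) ⊕g (⊥ : SimpleGraph (Fin r)))) := by
  classical
  let P : W → Prop := fun w => ∃ d, H.Adj w d
  let st : Setoid {w // P w} :=
    { r := fun a b => ¬ H.Adj a.1 b.1
      iseqv := ⟨fun a => H.loopless.irrefl _, fun h h' => h h'.symm, by
        rintro a ⟨b, d, hd⟩ c h1 h2
        exact hH _ _ _ d hd h1 h2⟩ }
  let Q := Quotient st
  let eQ : Q ≃ Fin (Nat.card Q) := Finite.equivFin Q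
  let pr : {w // P w} → Fin (Nat.card Q) := fun w => eQ (Quotient.mk st w)
  have hpr : ∀ a b, pr a = pr b ↔ ¬ H.Adj a.1 b.1 := by
    intro a b
    simp only [pr, EmbeddingLike.apply_eq_iff_eq]
    exact Quotient.eq
  let nn : Fin (Nat.card Q) → ℕ := fun i => Nat.card {w // pr w = i}
  let e1 : W ≃ (Σ i, Fin (nn i)) ⊕ Fin (Nat.card {w // ¬ P w}) :=
    (Equiv.sumCompl P).symm.trans (Equiv.sumCongr
      ((Equiv.sigmaFiberEquiv pr).symm.trans (Equiv.sigmaCongrRight fun i => Finite.equivFin _))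
      (Finite.equivFin _))
  refine ⟨Nat.card Q, Nat.card {w // ¬ P w}, nn, ?_, ?_, ⟨⟨e1, ?_⟩⟩⟩
  · intro i
    obtain ⟨q, rfl⟩ := eQ.surjective i
    obtain ⟨w, rfl⟩ := Quotient.exists_rep q
    have : Nonempty {w' // pr w' = eQ (Quotient.mk st w)} := ⟨⟨w, rfl⟩⟩
    exact Nat.card_pos
  · rw [Nat.card_congr e1]
    simp
  · intro a b
    have hP : ∀ x (h : P x), ∃ k, e1 x = Sum.inl ⟨pr ⟨x, h⟩, k⟩ := by
      intro x h
      refine ⟨Finite.equivFin _ ⟨⟨x, h⟩, rfl⟩, ?_⟩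
      simp only [e1, Equiv.trans_apply]
      rw [Equiv.sumCompl_symm_apply_of_pos h]
      rfl
    have hN : ∀ x (h : ¬ P x), ∃ k, e1 x = Sum.inr k := by
      intro x h
      refine ⟨Finite.equivFin _ ⟨x, h⟩, ?_⟩
      simp only [e1, Equiv.trans_apply]
      rw [Equiv.sumCompl_symm_apply_of_neg h]
      rfl
    by_cases ha : P a
    · obtain ⟨k, hk⟩ := hP a ha
      by_cases hb : P b
      · obtain ⟨k', hk'⟩ := hP b hb
        rw [hk, hk']
        have := hpr ⟨a, ha⟩ ⟨b, hb⟩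
        simp only [SimpleGraph.sum_adj, SimpleGraph.completeMultipartiteGraph, SimpleGraph.comap_adj, SimpleGraph.top_adj]
        rw [ne_eq, this, not_not]
      · obtain ⟨k', hk'⟩ := hN b hb
        rw [hk, hk']
        have : ¬ H.Adj a b := fun h => hb ⟨a, h.symm⟩
        simp [this]
    · have : ¬ H.Adj a b := fun h => ha ⟨b, h⟩
      obtain ⟨k, hk⟩ := hN a ha
      by_cases hb : P b
      · obtain ⟨k', hk'⟩ := hP b hb
        rw [hk, hk']
        simp [this]
      · obtain ⟨k', hk'⟩ := hN b hb
        rw [hk, hk']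
        simp [this]

theorem induced_Y_structure {n s : ℕ} (hs : 2 ≤ s) (hsn : s ≤ n - 3)
    (G : SimpleGraph (Fin n)) (hconn : G.Connected) (hG : memClass s G)
    (v : Fin n) (hv : IsMinDegVertex G v) (Y : Set (Fin n)) (hY : Y = Yset G v) :
    Y.Nonempty ∧
    (∃ (l r : ℕ) (nn : Fin l → ℕ), (∀ i, 1 ≤ nn i) ∧
      (∑ i, nn i) + r = n - deg G v - 1 ∧
      Nonempty ((G.induce Y) ≃g
        ((SimpleGraph.completeMultipartiteGraph fun i => Fin (nn i)) ⊕g (⊥ : SimpleGraph (Fin r))))) ∧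
    posCount (G.induce Y) ≤ 1 := by
  classical
  have hvn : v ∉ G.neighborSet v := G.loopless.irrefl v
  have hcard : Nat.card Y = n - deg G v - 1 := by
    have h1 := Set.ncard_compl (G.neighborSet v ∪ {v})
    rw [Set.union_singleton, Set.ncard_insert_of_notMem hvn, ← Set.union_singleton] at h1
    rw [hY, Yset, Nat.card_coe_set_eq, h1, deg, Nat.card_coe_set_eq, Nat.card_fin]
    omega
  have hmemY : ∀ y, y ∈ Y ↔ ¬ G.Adj v y ∧ y ≠ v := by
    intro y; rw [hY]; simp [Yset, and_comm]
  have hne : Y.Nonempty := by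
    by_contra hem
    rw [Set.not_nonempty_iff_eq_empty] at hem
    have hd : ∀ w, n - 1 ≤ deg G w := by
      intro w
      have := hv w
      have h0 : Nat.card Y = 0 := by rw [hem]; simp
      omega
    have hcomp : ∀ a b, a ≠ b → G.Adj a b := by
      intro a b hab
      by_contra hn
      have hsub : G.neighborSet a ⊆ ({a, b} : Set (Fin n))ᶜ := by
        intro x hx
        simp only [Set.mem_compl_iff, Set.mem_insert_iff, Set.mem_singleton_iff, not_or]
        exact ⟨fun h => G.loopless.irrefl a (h ▸ hx), fun h => hn (h ▸ hx)⟩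
      have h1 := Set.ncard_le_ncard hsub
      rw [Set.ncard_compl, Set.ncard_pair hab, Nat.card_fin] at h1
      have h2 := hd a
      rw [deg, Nat.card_coe_set_eq] at h2
      omega
    have := posCount_complete G hcomp
    have := hG.1
    omega
  have : Nontrivial (Fin n) := Fin.nontrivial_iff_two_le.mpr (by omega)
  obtain ⟨u, hu⟩ := hconn.preconnected.exists_adj_of_nontrivial v
  have hp : posCount (G.induce Y) ≤ 1 := by
    have := posCount_induce G u v hu.symm Y (fun y hy => ((hmemY y).1 hy).1)
    have := hG.1
    omega
  refine ⟨hne, ?_, hp⟩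
  rw [← hcard]
  exact exists_iso _ (fun a b c d => nonadj_trans _ hp a b c d)

end TwoPosEig
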